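/- For the Chow-Liu objective: if P is a distribution on ℝⁿ and T a tree on [n], the reverse-KL projection onto T-structured distributions satisfies D_KL(P‖P_T) = J_P − wt_P(T), where J_P = Σ_v H(P_v) − H(P) and wt_P(T) = Σ_{(u,v)∈T} I(X_u; X_v). Consequently, the best tree structure is a maximum-weight spanning tree with respect to the pairwise mutual informations. -/

import Mathlib

open MeasureTheory Matrix

open scoped Classical

noncomputable section

/-- Density of the `n`-variate Gaussian with mean `μ` and covariance matrix `S`. -/
def gaussDensity (n : ℕ) (μ : Fin n → ℝ) (S : Matrix (Fin n) (Fin n) ℝ)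
    (x : Fin n → ℝ) : ℝ :=
  (2 * Real.pi) ^ (-(n : ℝ) / 2) * S.det ^ (-(1 : ℝ) / 2) *
    Real.exp (-(1 / 2) * ((x - μ) ⬝ᵥ (S⁻¹ *ᵥ (x - μ))))

/-- Differential entropy of a measure with respect to the ambient volume measure. -/
def diffEntropy {α : Type*} [MeasureSpace α] (μ : Measure α) : ℝ :=
  -∫ x, Real.log (μ.rnDeriv volume x).toReal ∂μ

lemma quad_upper (n : ℕ) (M : Matrix (Fin n) (Fin n) ℝ) :
    ∃ C > 0, ∀ y : Fin n → ℝ, y ⬝ᵥ (M *ᵥ y) ≤ C * ∑ i, y i ^ 2 := by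
  refine ⟨∑ i, ∑ j, |M i j| + 1, by positivity, fun y => ?_⟩
  have hs : ∀ i, y i ^ 2 ≤ ∑ i, y i ^ 2 := fun i =>
    Finset.single_le_sum (f := fun i => y i ^ 2) (fun _ _ => sq_nonneg _) (Finset.mem_univ i)
  have h0 : 0 ≤ ∑ i, y i ^ 2 := Finset.sum_nonneg fun _ _ => sq_nonneg _
  rw [add_mul, Finset.sum_mul]
  have : y ⬝ᵥ (M *ᵥ y) ≤ ∑ i, (∑ j, |M i j|) * ∑ i, y i ^ 2 := by
    simp only [dotProduct, mulVec]
    refine Finset.sum_le_sum fun i _ => ?_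
    rw [Finset.mul_sum, Finset.sum_mul]
    refine Finset.sum_le_sum fun j _ => ?_
    have h1 : |y i * y j| ≤ ∑ i, y i ^ 2 := by
      have := hs i; have := hs j
      rw [abs_le]; constructor <;> nlinarith [sq_nonneg (y i - y j), sq_nonneg (y i + y j)]
    calc y i * (M i j * y j) ≤ |y i * (M i j * y j)| := le_abs_self _
      _ = |M i j| * |y i * y j| := by rw [← abs_mul]; congr 1; ring
      _ ≤ _ := by gcongr
  linarith

open scoped MatrixOrder in
lemma quad_lower (n : ℕ) (M : Matrix (Fin n) (Fin n) ℝ) (hM : M.PosDef) :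
    ∃ c > 0, ∀ y : Fin n → ℝ, c * ∑ i, y i ^ 2 ≤ y ⬝ᵥ (M *ᵥ y) := by
  obtain ⟨B, rfl⟩ := CStarAlgebra.nonneg_iff_eq_star_mul_self.mp hM.posSemidef.nonneg
  have hB : IsUnit B.det := by
    have := hM.det_pos
    rw [det_mul] at this
    exact isUnit_iff_ne_zero.mpr (fun h => by simp [h] at this)
  obtain ⟨C, hC, h⟩ := quad_upper n (B⁻¹ᵀ * B⁻¹)
  refine ⟨C⁻¹, by positivity, fun y => ?_⟩
  have h1 := h (B *ᵥ y)
  rw [inv_mul_le_iff₀ hC]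
  have e1 : (B *ᵥ y) ⬝ᵥ ((B⁻¹ᵀ * B⁻¹) *ᵥ (B *ᵥ y)) = ∑ i, y i ^ 2 := by
    rw [← mulVec_mulVec, mulVec_mulVec _ B⁻¹ B, nonsing_inv_mul _ hB, one_mulVec,
      mulVec_transpose, dotProduct_comm, ← dotProduct_mulVec, mulVec_mulVec,
      nonsing_inv_mul _ hB, one_mulVec]
    simp [dotProduct, sq]
  have e2 : y ⬝ᵥ ((star B * B) *ᵥ y) = ∑ i, (B *ᵥ y) i ^ 2 := by
    rw [← mulVec_mulVec, dotProduct_mulVec, star_eq_conjTranspose, conjTranspose_eq_transpose_of_trivial,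
      vecMul_transpose]
    simp [dotProduct, sq]
  rw [e2]; rw [e1] at h1; exact h1

open ProbabilityTheory NNReal

lemma prod_pdf (n : ℕ) (m x : Fin n → ℝ) (v : ℝ≥0) :
    ∏ i, gaussianPDFReal (m i) v (x i) =
      ((Real.sqrt (2 * Real.pi * v))⁻¹) ^ n * Real.exp (-(∑ i, (x i - m i) ^ 2) / (2 * v)) := by
  simp only [gaussianPDFReal, Finset.prod_mul_distrib, Finset.prod_const, Finset.card_univ,
    Fintype.card_fin, ← Real.exp_sum]
  congr 2
  rw [← Finset.sum_div, Finset.sum_neg_distrib]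

lemma gauss_sandwich (n : ℕ) (m : Fin n → ℝ) (S : Matrix (Fin n) (Fin n) ℝ) (hS : S.PosDef) :
    (∃ K > 0, ∃ v : ℝ≥0, v ≠ 0 ∧ ∀ x, gaussDensity n m S x ≤ K * ∏ i, gaussianPDFReal (m i) v (x i)) ∧
    (∃ K > 0, ∃ v : ℝ≥0, v ≠ 0 ∧ ∀ x, K * ∏ i, gaussianPDFReal (m i) v (x i) ≤ gaussDensity n m S x) := by
  have hc : 0 < (2 * Real.pi) ^ (-(n : ℝ) / 2) * S.det ^ (-(1 : ℝ) / 2) := by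
    have := hS.det_pos
    positivity
  set c := (2 * Real.pi) ^ (-(n : ℝ) / 2) * S.det ^ (-(1 : ℝ) / 2) with hcdef
  have key : ∀ a : ℝ, 0 < a → ∃ K > 0, ∃ v : ℝ≥0, v ≠ 0 ∧ ∀ x : Fin n → ℝ,
      K * ∏ i, gaussianPDFReal (m i) v (x i) = c * Real.exp (-(1/2) * (a * ∑ i, (x i - m i) ^ 2)) := by
    intro a ha
    have hA : 0 < ((Real.sqrt (2 * Real.pi * a⁻¹))⁻¹) ^ n := by positivity
    have hco : ((Real.toNNReal a⁻¹ : ℝ≥0) : ℝ) = a⁻¹ := Real.coe_toNNReal _ (by positivity)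
    refine ⟨c / ((Real.sqrt (2 * Real.pi * a⁻¹))⁻¹) ^ n, by positivity,
      Real.toNNReal a⁻¹, ?_, fun x => ?_⟩
    · exact (Real.toNNReal_pos.2 (by positivity)).ne'
    · rw [prod_pdf, hco, ← mul_assoc, div_mul_cancel₀ _ hA.ne']
      congr 2
      field_simp
  obtain ⟨a, ha, hal⟩ := quad_lower n S⁻¹ hS.inv
  obtain ⟨b, hb, hbu⟩ := quad_upper n S⁻¹
  constructor
  · obtain ⟨K, hK, v, hv, h⟩ := key a ha
    refine ⟨K, hK, v, hv, fun x => ?_⟩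
    rw [h, gaussDensity, ← hcdef]
    have := hal (x - m)
    simp only [Pi.sub_apply] at this
    gcongr c * Real.exp ?_
    linarith
  · obtain ⟨K, hK, v, hv, h⟩ := key b hb
    refine ⟨K, hK, v, hv, fun x => ?_⟩
    rw [h, gaussDensity, ← hcdef]
    have := hbu (x - m)
    simp only [Pi.sub_apply] at this
    gcongr c * Real.exp ?_
    linarith

/-- the product Gaussian measure -/
def prodGauss (n : ℕ) (m : Fin n → ℝ) (v : ℝ≥0) : Measure (Fin n → ℝ) :=
  Measure.pi fun i => gaussianReal (m i) v

instance (n : ℕ) (m : Fin n → ℝ) (v : ℝ≥0) : IsProbabilityMeasure (prodGauss n m v) := by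
  unfold prodGauss; infer_instance

lemma prodGauss_eq (n : ℕ) (m : Fin n → ℝ) (v : ℝ≥0) (hv : v ≠ 0) :
    prodGauss n m v =
      volume.withDensity fun x => ENNReal.ofReal (∏ i, gaussianPDFReal (m i) v (x i)) := by
  refine Measure.pi_eq fun s hs => ?_
  rw [withDensity_apply _ (MeasurableSet.univ_pi hs), volume_pi, Measure.restrict_pi_pi,
    ← ofReal_integral_eq_lintegral_ofReal, integral_fintype_prod_eq_prod, ENNReal.ofReal_prod_of_nonneg]
  · refine Finset.prod_congr rfl fun i _ => ?_
    rw [gaussianReal_apply_eq_integral _ hv]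
  · intro i _
    exact integral_nonneg fun x => gaussianPDFReal_nonneg _ _ _
  · exact Integrable.fintype_prod_dep fun i => (integrable_gaussianPDFReal _ _).restrict
  · exact Filter.Eventually.of_forall fun x => Finset.prod_nonneg fun i _ => gaussianPDFReal_nonneg _ _ _

lemma prodGauss_map_one (n : ℕ) (m : Fin n → ℝ) (v : ℝ≥0) (hv : v ≠ 0) (i : Fin n) :
    (prodGauss n m v).map (fun x => x i) =
      volume.withDensity fun t => ENNReal.ofReal (gaussianPDFReal (m i) v t) := by
  rw [prodGauss, ← gaussianPDF_def, ← gaussianReal_of_var_ne_zero _ hv]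
  exact (measurePreserving_eval (fun i => gaussianReal (m i) v) i).map_eq

lemma prodGauss_map_two (n : ℕ) (m : Fin n → ℝ) (v : ℝ≥0) (hv : v ≠ 0) (i j : Fin n) (hij : i ≠ j) :
    (prodGauss n m v).map (fun x => (x i, x j)) =
      volume.withDensity fun t => ENNReal.ofReal (gaussianPDFReal (m i) v t.1 * gaussianPDFReal (m j) v t.2) := by
  have h := (iIndepFun_pi (μ := fun i => gaussianReal (m i) v) (X := fun _ t => t)
    (fun i => aemeasurable_id)).indepFun hij
  have h2 := (indepFun_iff_map_prod_eq_prod_map_map (measurable_pi_apply i).aemeasurable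
    (measurable_pi_apply j).aemeasurable).1 h
  change (prodGauss n m v).map (fun x => (x i, x j)) = ((prodGauss n m v).map (fun x => x i)).prod
    ((prodGauss n m v).map (fun x => x j)) at h2
  rw [h2, prodGauss_map_one _ _ _ hv, prodGauss_map_one _ _ _ hv, prod_withDensity (by fun_prop) (by fun_prop)]
  simp_rw [ENNReal.ofReal_mul (gaussianPDFReal_nonneg _ _ _)]
  rfl

lemma key_log {Ω α : Type*} [MeasurableSpace Ω] [MeasureSpace α] [SigmaFinite (volume : Measure α)]
    (P : Measure Ω) [IsFiniteMeasure P] (φ : Ω → α) (hφ : Measurable φ) (ha hb : α → ℝ)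
    (hbp : ∀ t, 0 < hb t) (hap : ∀ t, 0 < ha t) (hbm : Measurable hb)
    (h1 : P.map φ ≤ volume.withDensity fun t => ENNReal.ofReal (ha t))
    (h2 : (volume.withDensity fun t => ENNReal.ofReal (hb t)) ≤ P.map φ)
    (hai : Integrable (fun x => Real.log (ha (φ x))) P)
    (hbi : Integrable (fun x => Real.log (hb (φ x))) P) :
    (∀ᵐ x ∂P, 0 < ((P.map φ).rnDeriv volume (φ x)).toReal) ∧
      Integrable (fun x => Real.log ((P.map φ).rnDeriv volume (φ x)).toReal) P := by
  have hac : P.map φ ≪ volume :=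
    (Measure.absolutelyContinuous_of_le h1).trans (withDensity_absolutelyContinuous _ _)
  have hwd := Measure.withDensity_rnDeriv_eq _ _ hac
  have hmr := Measure.measurable_rnDeriv (P.map φ) volume
  have a1 : ∀ᵐ t, (P.map φ).rnDeriv volume t ≤ ENNReal.ofReal (ha t) := by
    refine ae_le_of_forall_setLIntegral_le_of_sigmaFinite hmr fun s hs _ => ?_
    rw [← withDensity_apply _ hs, ← withDensity_apply _ hs, hwd]
    exact h1 s
  have a2 : ∀ᵐ t, ENNReal.ofReal (hb t) ≤ (P.map φ).rnDeriv volume t := by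
    refine ae_le_of_forall_setLIntegral_le_of_sigmaFinite (by fun_prop) fun s hs _ => ?_
    rw [← withDensity_apply _ hs, ← withDensity_apply _ hs, hwd]
    exact h2 s
  have b : ∀ᵐ t, hb t ≤ ((P.map φ).rnDeriv volume t).toReal ∧
      ((P.map φ).rnDeriv volume t).toReal ≤ ha t := by
    filter_upwards [a1, a2] with t h1 h2
    have hlt := h1.trans_lt ENNReal.ofReal_lt_top
    exact ⟨(ENNReal.ofReal_le_iff_le_toReal hlt.ne).1 h2, ENNReal.toReal_le_of_le_ofReal (hap t).le h1⟩
  have b' := ae_of_ae_map hφ.aemeasurable (hac.ae_le b)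
  refine ⟨b'.mono fun x hx => (hbp _).trans_le hx.1, ?_⟩
  refine integrable_of_le_of_le ?_ ?_ ?_ hbi hai
  · exact ((hmr.comp hφ).ennreal_toReal.log).aestronglyMeasurable
  · exact b'.mono fun x hx => Real.log_le_log (hbp _) hx.1
  · exact b'.mono fun x hx => Real.log_le_log ((hbp _).trans_le hx.1) hx.2

lemma log_pdf (m : ℝ) (v : ℝ≥0) (hv : v ≠ 0) (t : ℝ) :
    Real.log (gaussianPDFReal m v t) =
      Real.log (Real.sqrt (2 * Real.pi * v))⁻¹ + -(t - m) ^ 2 / (2 * v) := by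
  have : (0 : ℝ) < v := by positivity
  rw [gaussianPDFReal, Real.log_mul (by positivity) (Real.exp_ne_zero _), Real.log_exp]

lemma gaussDensity_pos {n : ℕ} {m : Fin n → ℝ} {S : Matrix (Fin n) (Fin n) ℝ} (hS : S.PosDef)
    (x : Fin n → ℝ) : 0 < gaussDensity n m S x := by
  have := hS.det_pos
  unfold gaussDensity
  positivity

lemma gaussDensity_meas {n : ℕ} {m : Fin n → ℝ} {S : Matrix (Fin n) (Fin n) ℝ} :
    Measurable (gaussDensity n m S) := by
  refine Continuous.measurable ?_
  unfold gaussDensity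
  have : Continuous fun x : Fin n → ℝ => (x - m) ⬝ᵥ (S⁻¹ *ᵥ (x - m)) := by
    simp only [dotProduct, mulVec]
    fun_prop
  fun_prop

lemma P_sandwich (n : ℕ) (m : Fin n → ℝ) (S : Matrix (Fin n) (Fin n) ℝ) (hS : S.PosDef)
    (P : Measure (Fin n → ℝ))
    (hP : P = volume.withDensity (fun x => ENNReal.ofReal (gaussDensity n m S x))) :
    (∃ K > 0, ∃ v : ℝ≥0, v ≠ 0 ∧ P ≤ ENNReal.ofReal K • prodGauss n m v) ∧
    (∃ K > 0, ∃ v : ℝ≥0, v ≠ 0 ∧ ENNReal.ofReal K • prodGauss n m v ≤ P) := by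
  obtain ⟨⟨K, hK, v, hv, h⟩, ⟨K', hK', v', hv', h'⟩⟩ := gauss_sandwich n m S hS
  refine ⟨⟨K, hK, v, hv, ?_⟩, ⟨K', hK', v', hv', ?_⟩⟩
  · rw [prodGauss_eq _ _ _ hv, hP, ← withDensity_smul' _ _ ENNReal.ofReal_ne_top]
    refine withDensity_mono (Filter.Eventually.of_forall fun x => ?_)
    simp only [Pi.smul_apply, smul_eq_mul]
    rw [← ENNReal.ofReal_mul hK.le]
    exact ENNReal.ofReal_le_ofReal (h x)
  · rw [prodGauss_eq _ _ _ hv', hP, ← withDensity_smul' _ _ ENNReal.ofReal_ne_top]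
    refine withDensity_mono (Filter.Eventually.of_forall fun x => ?_)
    simp only [Pi.smul_apply, smul_eq_mul]
    rw [← ENNReal.ofReal_mul hK'.le]
    exact ENNReal.ofReal_le_ofReal (h' x)

lemma P_finite (n : ℕ) (m : Fin n → ℝ) (S : Matrix (Fin n) (Fin n) ℝ) (hS : S.PosDef)
    (P : Measure (Fin n → ℝ))
    (hP : P = volume.withDensity (fun x => ENNReal.ofReal (gaussDensity n m S x))) : IsFiniteMeasure P := by
  obtain ⟨⟨K, hK, v, hv, h⟩, -⟩ := P_sandwich n m S hS P hP
  refine ⟨(h _).trans_lt ?_⟩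
  simp

lemma P_sq (n : ℕ) (m : Fin n → ℝ) (S : Matrix (Fin n) (Fin n) ℝ) (hS : S.PosDef)
    (P : Measure (Fin n → ℝ))
    (hP : P = volume.withDensity (fun x => ENNReal.ofReal (gaussDensity n m S x))) (i : Fin n) : Integrable (fun x => (x i - m i) ^ 2) P := by
  obtain ⟨⟨K, hK, v, hv, h⟩, -⟩ := P_sandwich n m S hS P hP
  refine Integrable.mono_measure ?_ h
  refine Integrable.smul_measure ?_ ENNReal.ofReal_ne_top
  refine integrable_comp_eval (μ := fun i => gaussianReal (m i) v) (f := fun t => (t - m i) ^ 2) ?_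
  have h1 : MemLp id 2 (gaussianReal (m i) v) := memLp_id_gaussianReal 2
  exact (h1.sub (memLp_const (m i))).integrable_sq

lemma P_logpdf (n : ℕ) (m : Fin n → ℝ) (S : Matrix (Fin n) (Fin n) ℝ) (hS : S.PosDef)
    (P : Measure (Fin n → ℝ))
    (hP : P = volume.withDensity (fun x => ENNReal.ofReal (gaussDensity n m S x))) (v : ℝ≥0) (hv : v ≠ 0) (i : Fin n) :
    Integrable (fun x => Real.log (gaussianPDFReal (m i) v (x i))) P := by
  have := P_finite n m S hS P hP
  simp_rw [log_pdf _ _ hv]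
  exact (integrable_const _).add (((P_sq n m S hS P hP i).neg).div_const _)

lemma P_one (n : ℕ) (m : Fin n → ℝ) (S : Matrix (Fin n) (Fin n) ℝ) (hS : S.PosDef)
    (P : Measure (Fin n → ℝ))
    (hP : P = volume.withDensity (fun x => ENNReal.ofReal (gaussDensity n m S x))) (i : Fin n) :
    (∀ᵐ x ∂P, 0 < ((P.map (fun x => x i)).rnDeriv volume (x i)).toReal) ∧
      Integrable (fun x => Real.log ((P.map (fun x => x i)).rnDeriv volume (x i)).toReal) P := by
  have := P_finite n m S hS P hP
  obtain ⟨⟨K, hK, v, hv, h⟩, ⟨K', hK', v', hv', h'⟩⟩ := P_sandwich n m S hS P hP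
  have hφ : Measurable (fun x : Fin n → ℝ => x i) := by fun_prop
  have hp : ∀ t, 0 < K * gaussianPDFReal (m i) v t := fun t => mul_pos hK (gaussianPDFReal_pos _ _ _ hv)
  have hp' : ∀ t, 0 < K' * gaussianPDFReal (m i) v' t := fun t => mul_pos hK' (gaussianPDFReal_pos _ _ _ hv')
  refine key_log P (fun x => x i) hφ (fun t => K * gaussianPDFReal (m i) v t)
    (fun t => K' * gaussianPDFReal (m i) v' t) hp' hp (by fun_prop) ?_ ?_ ?_ ?_
  · refine (Measure.map_mono h hφ).trans_eq ?_
    rw [Measure.map_smul, prodGauss_map_one _ _ _ hv, ← withDensity_smul' _ _ ENNReal.ofReal_ne_top]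
    simp_rw [ENNReal.ofReal_mul hK.le]; rfl
  · refine Eq.trans_le ?_ (Measure.map_mono h' hφ)
    rw [Measure.map_smul, prodGauss_map_one _ _ _ hv', ← withDensity_smul' _ _ ENNReal.ofReal_ne_top]
    simp_rw [ENNReal.ofReal_mul hK'.le]; rfl
  · simp_rw [fun t => Real.log_mul hK.ne' (gaussianPDFReal_pos (m i) v t hv).ne']
    exact (integrable_const _).add (P_logpdf n m S hS P hP v hv i)
  · simp_rw [fun t => Real.log_mul hK'.ne' (gaussianPDFReal_pos (m i) v' t hv').ne']
    exact (integrable_const _).add (P_logpdf n m S hS P hP v' hv' i)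

lemma P_two (n : ℕ) (m : Fin n → ℝ) (S : Matrix (Fin n) (Fin n) ℝ) (hS : S.PosDef)
    (P : Measure (Fin n → ℝ))
    (hP : P = volume.withDensity (fun x => ENNReal.ofReal (gaussDensity n m S x))) (i j : Fin n) (hij : i ≠ j) :
    (∀ᵐ x ∂P, 0 < ((P.map (fun x => (x i, x j))).rnDeriv volume (x i, x j)).toReal) ∧
      Integrable (fun x => Real.log ((P.map (fun x => (x i, x j))).rnDeriv volume (x i, x j)).toReal) P := by
  have := P_finite n m S hS P hP
  obtain ⟨⟨K, hK, v, hv, h⟩, ⟨K', hK', v', hv', h'⟩⟩ := P_sandwich n m S hS P hP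
  have hφ : Measurable (fun x : Fin n → ℝ => (x i, x j)) := by fun_prop
  have hq : ∀ v : ℝ≥0, v ≠ 0 → ∀ t : ℝ × ℝ,
      0 < gaussianPDFReal (m i) v t.1 * gaussianPDFReal (m j) v t.2 := fun v hv t =>
    mul_pos (gaussianPDFReal_pos _ _ _ hv) (gaussianPDFReal_pos _ _ _ hv)
  have hlog : ∀ (K : ℝ) (v : ℝ≥0), 0 < K → v ≠ 0 → Integrable (fun x : Fin n → ℝ =>
      Real.log (K * (gaussianPDFReal (m i) v (x i) * gaussianPDFReal (m j) v (x j)))) P := by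
    intro K v hK hv
    have e : (fun x : Fin n → ℝ =>
      Real.log (K * (gaussianPDFReal (m i) v (x i) * gaussianPDFReal (m j) v (x j)))) =
      fun x => Real.log K + (Real.log (gaussianPDFReal (m i) v (x i)) +
        Real.log (gaussianPDFReal (m j) v (x j))) := by
      funext x
      have h1 := (gaussianPDFReal_pos (m i) v (x i) hv).ne'
      have h2 := (gaussianPDFReal_pos (m j) v (x j) hv).ne'
      rw [Real.log_mul hK.ne' (mul_ne_zero h1 h2), Real.log_mul h1 h2]
    rw [e]
    exact (integrable_const _).add
      ((P_logpdf n m S hS P hP v hv i).add (P_logpdf n m S hS P hP v hv j))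
  refine key_log P (fun x => (x i, x j)) hφ
    (fun t => K * (gaussianPDFReal (m i) v t.1 * gaussianPDFReal (m j) v t.2))
    (fun t => K' * (gaussianPDFReal (m i) v' t.1 * gaussianPDFReal (m j) v' t.2))
    (fun t => mul_pos hK' (hq v' hv' t)) (fun t => mul_pos hK (hq v hv t)) (by fun_prop) ?_ ?_
    (hlog K v hK hv) (hlog K' v' hK' hv')
  · refine (Measure.map_mono h hφ).trans_eq ?_
    rw [Measure.map_smul, prodGauss_map_two _ _ _ hv _ _ hij, ← withDensity_smul' _ _ ENNReal.ofReal_ne_top]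
    simp_rw [ENNReal.ofReal_mul hK.le]; rfl
  · refine Eq.trans_le ?_ (Measure.map_mono h' hφ)
    rw [Measure.map_smul, prodGauss_map_two _ _ _ hv' _ _ hij, ← withDensity_smul' _ _ ENNReal.ofReal_ne_top]
    simp_rw [ENNReal.ofReal_mul hK'.le]; rfl

lemma P_self (n : ℕ) (m : Fin n → ℝ) (S : Matrix (Fin n) (Fin n) ℝ) (hS : S.PosDef)
    (P : Measure (Fin n → ℝ))
    (hP : P = volume.withDensity (fun x => ENNReal.ofReal (gaussDensity n m S x))) : Integrable (fun x => Real.log (gaussDensity n m S x)) P := by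
  have := P_finite n m S hS P hP
  obtain ⟨⟨K, hK, v, hv, h⟩, ⟨K', hK', v', hv', h'⟩⟩ := gauss_sandwich n m S hS
  have hpr : ∀ (v : ℝ≥0), v ≠ 0 → ∀ x : Fin n → ℝ, 0 < ∏ i, gaussianPDFReal (m i) v (x i) :=
    fun v hv x => Finset.prod_pos fun i _ => gaussianPDFReal_pos _ _ _ hv
  have hlog : ∀ (K : ℝ) (v : ℝ≥0), 0 < K → v ≠ 0 → Integrable (fun x : Fin n → ℝ =>
      Real.log (K * ∏ i, gaussianPDFReal (m i) v (x i))) P := by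
    intro K v hK hv
    have e : (fun x : Fin n → ℝ => Real.log (K * ∏ i, gaussianPDFReal (m i) v (x i))) =
      fun x => Real.log K + ∑ i, Real.log (gaussianPDFReal (m i) v (x i)) := by
      funext x
      rw [Real.log_mul hK.ne' (hpr v hv x).ne', Real.log_prod]
      exact fun i _ => (gaussianPDFReal_pos (m i) v (x i) hv).ne'
    rw [e]
    exact (integrable_const _).add
      (integrable_finsetSum _ fun i _ => P_logpdf n m S hS P hP v hv i)
  refine integrable_of_le_of_le gaussDensity_meas.log.aestronglyMeasurable
    (Filter.Eventually.of_forall fun x => Real.log_le_log (mul_pos hK' (hpr v' hv' x)) (h' x))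
    (Filter.Eventually.of_forall fun x => Real.log_le_log (gaussDensity_pos hS x) (h x))
    (hlog K' v' hK' hv') (hlog K v hK hv)

lemma entropy_self (n : ℕ) (m : Fin n → ℝ) (S : Matrix (Fin n) (Fin n) ℝ) (hS : S.PosDef)
    (P : Measure (Fin n → ℝ))
    (hP : P = volume.withDensity (fun x => ENNReal.ofReal (gaussDensity n m S x))) : diffEntropy P = -∫ x, Real.log (gaussDensity n m S x) ∂P := by
  have hac : P ≪ volume := hP ▸ withDensity_absolutelyContinuous _ _
  have h := Measure.rnDeriv_withDensity (volume : Measure (Fin n → ℝ))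
    (f := fun x => ENNReal.ofReal (gaussDensity n m S x)) gaussDensity_meas.ennreal_ofReal
  rw [← hP] at h
  rw [diffEntropy]
  congr 1
  refine integral_congr_ae ?_
  filter_upwards [hac.ae_le h] with x hx
  rw [hx, ENNReal.toReal_ofReal (gaussDensity_pos hS x).le]

lemma entropy_map (n : ℕ) (P : Measure (Fin n → ℝ)) {α : Type*} [MeasureSpace α] (φ : (Fin n → ℝ) → α) (hφ : Measurable φ) :
    diffEntropy (P.map φ) = -∫ x, Real.log ((P.map φ).rnDeriv volume (φ x)).toReal ∂P := by
  rw [diffEntropy, integral_map hφ.aemeasurable]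
  exact (Measure.measurable_rnDeriv _ _).ennreal_toReal.log.aestronglyMeasurable

/-- Chow–Liu objective: for a nondegenerate `n`-variate Gaussian `P` and a tree `T` on
`[n]`, the reverse-KL projection `P_T` of `P` onto `T`-structured distributions (whose
density `q` factorizes along `T` using the marginals of `P`) satisfies
`D_KL(P‖P_T) = J_P − wt_P(T)` where `J_P = Σ_v H(P_v) − H(P)` and
`wt_P(T) = Σ_{(u,v)∈T} I(X_u;X_v)`.  Consequently, among trees, the KL cost is
minimized exactly by maximizing the total mutual-information weight, i.e. the best
tree structure is a maximum-weight spanning tree for the pairwise mutual informations. -/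
theorem chow_liu_objective (n : ℕ) (hn : 0 < n) (μ0 : Fin n → ℝ)
    (S : Matrix (Fin n) (Fin n) ℝ) (hS : S.PosDef)
    (P : Measure (Fin n → ℝ))
    (hP : P = volume.withDensity (fun x => ENNReal.ofReal (gaussDensity n μ0 S x)))
    (T : SimpleGraph (Fin n)) (hT : T.IsTree) :
    -- marginal densities of `P`
    let f : Fin n → ℝ → ℝ :=
      fun v t => ((P.map (fun x => x v)).rnDeriv volume t).toReal
    let g : Fin n → Fin n → ℝ × ℝ → ℝ :=
      fun u v s => ((P.map (fun x => (x u, x v))).rnDeriv volume s).toReal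
    -- marginal entropies and pairwise mutual informations under `P`
    let Hv : Fin n → ℝ := fun v => diffEntropy (P.map (fun x => x v))
    let Hpair : Fin n → Fin n → ℝ := fun u v => diffEntropy (P.map (fun x => (x u, x v)))
    let I : Fin n → Fin n → ℝ := fun u v => Hv u + Hv v - Hpair u v
    let J : ℝ := (∑ v, Hv v) - diffEntropy P
    -- total mutual-information weight of a graph (each edge counted once)
    let wtOf : SimpleGraph (Fin n) → ℝ :=
      fun G => (1 / 2) * ∑ u, ∑ v, if G.Adj u v then I u v else 0
    -- density of the tree-structured projection `P_G` of `P` onto a graph `G`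
    let qOf : SimpleGraph (Fin n) → (Fin n → ℝ) → ℝ :=
      fun G x => (∏ v, f v (x v)) *
        ∏ u, ∏ v, if G.Adj u v then
          Real.sqrt (g u v (x u, x v) / (f u (x u) * f v (x v))) else 1
    -- reverse KL divergence `D_KL(P ‖ P_G)`
    let klOf : SimpleGraph (Fin n) → ℝ :=
      fun G => ∫ x, gaussDensity n μ0 S x *
        Real.log (gaussDensity n μ0 S x / qOf G x)
    klOf T = J - wtOf T ∧
      ∀ T' : SimpleGraph (Fin n), T'.IsTree → (klOf T ≤ klOf T' ↔ wtOf T' ≤ wtOf T) := by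
  intro f g Hv Hpair I J wtOf qOf klOf
  suffices main : ∀ G : SimpleGraph (Fin n), klOf G = J - wtOf G by
    refine ⟨main T, fun T' _ => ?_⟩
    rw [main T, main T']
    constructor <;> intro h <;> linarith
  intro G
  have hfin := P_finite n μ0 S hS P hP
  have hf : ∀ v, (∀ᵐ x ∂P, 0 < f v (x v)) ∧ Integrable (fun x => Real.log (f v (x v))) P :=
    fun v => P_one n μ0 S hS P hP v
  have hg : ∀ u v, G.Adj u v → (∀ᵐ x ∂P, 0 < g u v (x u, x v)) ∧
      Integrable (fun x => Real.log (g u v (x u, x v))) P :=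
    fun u v h => P_two n μ0 S hS P hP u v h.ne
  have hp := P_self n μ0 S hS P hP
  have hHv : ∀ v, Hv v = -∫ x, Real.log (f v (x v)) ∂P :=
    fun v => entropy_map n P (fun x => x v) (by fun_prop)
  have hHp : ∀ u v, Hpair u v = -∫ x, Real.log (g u v (x u, x v)) ∂P :=
    fun u v => entropy_map n P (fun x => (x u, x v)) (by fun_prop)
  have hH : diffEntropy P = -∫ x, Real.log (gaussDensity n μ0 S x) ∂P :=
    entropy_self n μ0 S hS P hP
  -- rewrite the divergence as an integral with respect to `P`
  have hkl : klOf G = ∫ x, Real.log (gaussDensity n μ0 S x / qOf G x) ∂P := by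
    rw [hP, integral_withDensity_eq_integral_toReal_smul gaussDensity_meas.ennreal_ofReal
      (Filter.Eventually.of_forall fun x => ENNReal.ofReal_lt_top)]
    refine integral_congr_ae (Filter.Eventually.of_forall fun x => ?_)
    simp only [smul_eq_mul, ENNReal.toReal_ofReal (gaussDensity_pos hS x).le]
  let L : Fin n → Fin n → (Fin n → ℝ) → ℝ := fun u v x => if G.Adj u v then
    Real.log (g u v (x u, x v)) - Real.log (f u (x u)) - Real.log (f v (x v)) else 0
  have hL : ∀ u v, Integrable (L u v) P := by
    intro u v
    by_cases h : G.Adj u v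
    · simp only [L, h, if_true]
      exact ((hg u v h).2.sub (hf u).2).sub (hf v).2
    · simp only [L, h, if_false]
      exact integrable_const _
  have hLI : ∀ u v, ∫ x, L u v x ∂P = if G.Adj u v then I u v else 0 := by
    intro u v
    by_cases h : G.Adj u v
    · simp only [L, h, if_true]
      have hgf : Integrable (fun x => Real.log (g u v (x u, x v)) - Real.log (f u (x u))) P :=
        (hg u v h).2.sub (hf u).2
      rw [integral_sub hgf (hf v).2, integral_sub (hg u v h).2 (hf u).2]
      simp only [I, hHv, hHp]
      ring
    · simp [L, h]
  have hlog : ∀ᵐ x ∂P, Real.log (gaussDensity n μ0 S x / qOf G x) =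
      Real.log (gaussDensity n μ0 S x) - ∑ v, Real.log (f v (x v))
        - (1 / 2) * ∑ u, ∑ v, L u v x := by
    have h1 : ∀ᵐ x ∂P, ∀ v, 0 < f v (x v) := ae_all_iff.2 fun v => (hf v).1
    have h2 : ∀ᵐ x ∂P, ∀ u v, G.Adj u v → 0 < g u v (x u, x v) := by
      refine ae_all_iff.2 fun u => ae_all_iff.2 fun v => ?_
      by_cases h : G.Adj u v
      · exact (hg u v h).1.mono fun x hx _ => hx
      · exact Filter.Eventually.of_forall fun x hx => absurd hx h
    filter_upwards [h1, h2] with x h1 h2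
    have hq : ∀ u v, 0 < (if G.Adj u v then
        Real.sqrt (g u v (x u, x v) / (f u (x u) * f v (x v))) else 1) := by
      intro u v
      split_ifs with h
      · exact Real.sqrt_pos.2 (div_pos (h2 u v h) (mul_pos (h1 u) (h1 v)))
      · exact one_pos
    have hpf : 0 < ∏ v, f v (x v) := Finset.prod_pos fun v _ => h1 v
    have hpq := fun u => Finset.prod_pos fun v (_ : v ∈ Finset.univ) => hq u v
    have hpq' := Finset.prod_pos fun u (_ : u ∈ Finset.univ) => hpq u
    have hlq : ∀ u v, Real.log (if G.Adj u v then
        Real.sqrt (g u v (x u, x v) / (f u (x u) * f v (x v))) else 1) = (1 / 2) * L u v x := by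
      intro u v
      by_cases h : G.Adj u v
      · simp only [L, h, if_true]
        rw [Real.log_sqrt (div_pos (h2 u v h) (mul_pos (h1 u) (h1 v))).le,
          Real.log_div (h2 u v h).ne' (mul_pos (h1 u) (h1 v)).ne',
          Real.log_mul (h1 u).ne' (h1 v).ne']
        ring
      · simp [L, h]
    rw [Real.log_div (gaussDensity_pos hS x).ne' (mul_pos hpf hpq').ne',
      Real.log_mul hpf.ne' hpq'.ne', Real.log_prod (fun v _ => (h1 v).ne'),
      Real.log_prod (fun u _ => (hpq u).ne')]
    simp_rw [fun u => Real.log_prod (fun v (_ : v ∈ Finset.univ) => (hq u v).ne'), hlq,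
      ← Finset.mul_sum]
    ring
  have hfs : Integrable (fun x => ∑ v, Real.log (f v (x v))) P :=
    integrable_finsetSum _ fun v _ => (hf v).2
  have hLs' : ∀ u, Integrable (fun x => ∑ v, L u v x) P :=
    fun u => integrable_finsetSum _ fun v _ => hL u v
  have hLs : Integrable (fun x => ∑ u, ∑ v, L u v x) P :=
    integrable_finsetSum _ fun u _ => hLs' u
  have hpf : Integrable (fun x => Real.log (gaussDensity n μ0 S x)
      - ∑ v, Real.log (f v (x v))) P := hp.sub hfs
  rw [hkl, integral_congr_ae hlog, integral_sub hpf (hLs.const_mul _),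
    integral_sub hp hfs, integral_const_mul, integral_finsetSum _ (fun v _ => (hf v).2),
    integral_finsetSum _ (fun u _ => hLs' u)]
  simp_rw [fun u => integral_finsetSum Finset.univ (fun v _ => hL u v), hLI]
  simp only [J, wtOf, hH, hHv, Finset.sum_neg_distrib]
  ring
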